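/- arXiv:2011.00412 — 2 statements merged into one kernel-verified Lean document; each statement's English description precedes it below -/
import Mathlib

section
/- Let V be a Banach space, v ∈ V with ‖v‖ ≤ 1, and δ : V ⊕_p V → V a linear contraction (with respect to the norm ‖(v₁,v₂)‖ = ((1/2)(‖v₁‖^p + ‖v₂‖^p))^{1/p}, 1 ≤ p < ∞) satisfying δ(v,v)=v. Then there exists a unique linear contraction θ : L^p[0,1] → V with θ(1) = v and θ ∘ γ = δ ∘ (θ ⊕ θ), where γ is the juxtaposition map. -/
open MeasureTheory ENNReal

local notation "μ01" => MeasureTheory.volume.restrict (Set.Icc (0:ℝ) 1)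

theorem map_two_mul_restrict_Icc :
    Measure.map (fun x : ℝ => 2 * x) ((μ01).restrict (Set.Iio (1 / 2))) = (2⁻¹ : ℝ≥0∞) • μ01 := by
  have hpre : (fun x : ℝ => 2 * x) ⁻¹' Set.Ico 0 1 = Set.Iio (1 / 2) ∩ Set.Icc 0 1 := by
    ext x
    simp only [Set.mem_preimage, Set.mem_Ico, Set.mem_inter_iff, Set.mem_Iio, Set.mem_Icc]
    constructor
    · rintro ⟨h1, h2⟩
      exact ⟨by linarith, by linarith, by linarith⟩
    · rintro ⟨h1, h2, h3⟩
      exact ⟨by linarith, by linarith⟩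
  rw [Measure.restrict_restrict measurableSet_Iio, ← hpre,
    ← Measure.restrict_map (measurable_const_mul 2) measurableSet_Ico,
    Real.map_volume_mul_left two_ne_zero, Measure.restrict_smul,
    Measure.restrict_congr_set Ico_ae_eq_Icc, abs_of_pos (by norm_num),
    ENNReal.ofReal_inv_of_pos two_pos, ENNReal.ofReal_ofNat]

theorem map_two_mul_sub_one_restrict_Icc :
    Measure.map (fun x : ℝ => 2 * x - 1) ((μ01).restrict (Set.Iio (1 / 2))ᶜ) =
      (2⁻¹ : ℝ≥0∞) • μ01 := by
  have hpre : (fun x : ℝ => 2 * x - 1) ⁻¹' Set.Icc 0 1 = (Set.Iio (1 / 2))ᶜ ∩ Set.Icc 0 1 := by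
    ext x
    simp only [Set.mem_preimage, Set.mem_Icc, Set.mem_inter_iff, Set.mem_compl_iff, Set.mem_Iio,
      not_lt]
    constructor
    · rintro ⟨h1, h2⟩
      exact ⟨by linarith, by linarith, by linarith⟩
    · rintro ⟨h1, h2, h3⟩
      exact ⟨by linarith, by linarith⟩
  have hmap : Measure.map (fun x : ℝ => 2 * x - 1) volume = (2⁻¹ : ℝ≥0∞) • volume := by
    have h : (fun x : ℝ => 2 * x - 1) = (fun x => x - 1) ∘ (fun x => 2 * x) := rfl
    rw [h, ← Measure.map_map (measurable_sub_const 1) (measurable_const_mul 2),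
      Real.map_volume_mul_left two_ne_zero, Measure.map_smul,
      (measurePreserving_sub_right volume (1 : ℝ)).map_eq, abs_of_pos (by norm_num),
      ENNReal.ofReal_inv_of_pos two_pos, ENNReal.ofReal_ofNat]
  rw [Measure.restrict_restrict measurableSet_Iio.compl, ← hpre,
    ← Measure.restrict_map (by fun_prop) measurableSet_Icc, hmap, Measure.restrict_smul]

theorem ae_two_mul_of_ae {P : ℝ → Prop} (h : ∀ᵐ x ∂μ01, P x) :
    ∀ᵐ x ∂μ01, x < 1 / 2 → P (2 * x) := by
  have h' : ∀ᵐ x ∂((2⁻¹ : ℝ≥0∞) • μ01), P x := Measure.ae_smul_measure h _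
  rw [← map_two_mul_restrict_Icc] at h'
  exact (ae_restrict_iff' measurableSet_Iio).1
    (ae_of_ae_map (measurable_const_mul (2 : ℝ)).aemeasurable h')

theorem ae_two_mul_sub_one_of_ae {P : ℝ → Prop} (h : ∀ᵐ x ∂μ01, P x) :
    ∀ᵐ x ∂μ01, ¬ x < 1 / 2 → P (2 * x - 1) := by
  have h' : ∀ᵐ x ∂((2⁻¹ : ℝ≥0∞) • μ01), P x := Measure.ae_smul_measure h _
  rw [← map_two_mul_sub_one_restrict_Icc] at h'
  have hm : Measurable fun x : ℝ => 2 * x - 1 := by fun_prop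
  exact (ae_restrict_iff' measurableSet_Iio.compl).1 (ae_of_ae_map hm.aemeasurable h')

/-- Juxtaposition of functions respects almost everywhere relations on `[0,1]`. -/
theorem ae_juxtaposition {β : Type*} {f f' g g' : ℝ → β} (hf : f =ᵐ[μ01] f') (hg : g =ᵐ[μ01] g') :
    (fun x : ℝ => if x < 1 / 2 then f (2 * x) else g (2 * x - 1)) =ᵐ[μ01]
      fun x => if x < 1 / 2 then f' (2 * x) else g' (2 * x - 1) := by
  filter_upwards [ae_two_mul_of_ae hf, ae_two_mul_sub_one_of_ae hg] with x h1 h2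
  split_ifs with h
  exacts [h1 h, h2 h]

theorem lintegral_juxtaposition {F G : ℝ → ℝ≥0∞} (hF : AEMeasurable F μ01)
    (hG : AEMeasurable G μ01) :
    ∫⁻ x, (if x < 1 / 2 then F (2 * x) else G (2 * x - 1)) ∂μ01 =
      2⁻¹ * (∫⁻ x, F x ∂μ01 + ∫⁻ x, G x ∂μ01) := by
  have hm : Measurable fun x : ℝ => 2 * x - 1 := by fun_prop
  have h1 : ∫⁻ x in Set.Iio (1 / 2), (if x < 1 / 2 then F (2 * x) else G (2 * x - 1)) ∂μ01 =
      2⁻¹ * ∫⁻ x, F x ∂μ01 := by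
    rw [setLIntegral_congr_fun (g := fun x => F (2 * x)) measurableSet_Iio
      (show Set.EqOn (fun x : ℝ => if x < 1 / 2 then F (2 * x) else G (2 * x - 1)) _ _ from
        fun x hx => if_pos hx), ← lintegral_map' (f := F) (g := fun x : ℝ => 2 * x)
      (by rw [map_two_mul_restrict_Icc]; exact hF.smul_measure _)
      (measurable_const_mul 2).aemeasurable, map_two_mul_restrict_Icc, lintegral_smul_measure,
      smul_eq_mul]
  have h2 : ∫⁻ x in (Set.Iio (1 / 2))ᶜ, (if x < 1 / 2 then F (2 * x) else G (2 * x - 1)) ∂μ01 =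
      2⁻¹ * ∫⁻ x, G x ∂μ01 := by
    rw [setLIntegral_congr_fun (g := fun x => G (2 * x - 1)) measurableSet_Iio.compl
      (show Set.EqOn (fun x : ℝ => if x < 1 / 2 then F (2 * x) else G (2 * x - 1)) _ _ from
        fun x hx => if_neg hx), ← lintegral_map' (f := G) (g := fun x : ℝ => 2 * x - 1)
      (by rw [map_two_mul_sub_one_restrict_Icc]; exact hG.smul_measure _)
      hm.aemeasurable, map_two_mul_sub_one_restrict_Icc, lintegral_smul_measure, smul_eq_mul]
  rw [← lintegral_add_compl _ (measurableSet_Iio (a := (1 / 2 : ℝ))), h1, h2, mul_add]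

/-- A subspace of `L^p` of a finite measure on `ℝ` that is closed and contains the constants and
the indicators of lower half-lines is everything. -/
theorem Lp_submodule_eq_top_of_Iic_mem {𝕜 : Type*} [RCLike 𝕜] {p : ℝ≥0∞} [Fact (1 ≤ p)]
    (hp : p ≠ ∞) {μ : Measure ℝ} [IsFiniteMeasure μ] (S : Submodule 𝕜 (Lp 𝕜 p μ))
    (hS : IsClosed (S : Set (Lp 𝕜 p μ)))
    (huniv : indicatorConstLp p MeasurableSet.univ (measure_ne_top μ _) (1 : 𝕜) ∈ S)
    (hIic : ∀ a : ℝ, indicatorConstLp p (measurableSet_Iic (a := a)) (measure_ne_top μ _) (1 : 𝕜)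
      ∈ S) : S = ⊤ := by
  have hset : ∀ (s : Set ℝ) (hs : MeasurableSet s),
      indicatorConstLp p hs (measure_ne_top μ _) (1 : 𝕜) ∈ S := by
    intro s hs
    induction s, hs using MeasurableSpace.induction_on_inter
      ((BorelSpace.measurable_eq (α := ℝ)).trans (borel_eq_generateFrom_Iic ℝ))
      isPiSystem_Iic with
    | empty => rw [indicatorConstLp_empty]; exact S.zero_mem
    | basic t ht =>
      obtain ⟨a, rfl⟩ := ht
      exact hIic a
    | compl t ht ih =>
      have h := indicatorConstLp_disjoint_union ht ht.compl (measure_ne_top μ _)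
        (measure_ne_top μ _) disjoint_compl_right (1 : 𝕜) (p := p)
      simp only [Set.union_compl_self] at h
      rw [h] at huniv
      exact (S.add_mem_iff_right ih).1 huniv
    | iUnion f hd hf ih =>
      have hacc : ∀ n, MeasurableSet (Set.accumulate f n) := fun n =>
        MeasurableSet.biUnion (Set.to_countable _) fun i _ => hf i
      have hmem : ∀ n, indicatorConstLp p (hacc n) (measure_ne_top μ _) (1 : 𝕜) ∈ S := by
        intro n
        induction n with
        | zero => simpa only [Set.accumulate_zero_nat] using ih 0
        | succ n ihn =>
          have hdis : Disjoint (Set.accumulate f n) (f (n + 1)) :=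
            Set.disjoint_accumulate hd n.lt_succ_self
          have h := indicatorConstLp_disjoint_union (hacc n) (hf (n + 1)) (measure_ne_top μ _)
            (measure_ne_top μ _) hdis (1 : 𝕜) (p := p)
          simp only [Set.accumulate_succ]
          rw [h]
          exact S.add_mem ihn (ih _)
      refine hS.mem_of_tendsto (b := Filter.atTop)
        (tendsto_indicatorConstLp_set hp ?_) (Filter.Eventually.of_forall hmem)
      have hsub : ∀ n, Set.accumulate f n ⊆ ⋃ i, f i := fun n => Set.accumulate_subset_iUnion n
      have heq : ∀ n, symmDiff (Set.accumulate f n) (⋃ i, f i) =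
          (⋃ i, f i) \ Set.accumulate f n := fun n => by
        rw [symmDiff_of_le (hsub n)]
      simp only [heq]
      have h := tendsto_measure_iInter_atTop (μ := μ)
        (s := fun n => (⋃ i, f i) \ Set.accumulate f n)
        (fun n => ((MeasurableSet.iUnion hf).diff (hacc n)).nullMeasurableSet)
        (fun m n hmn => Set.sdiff_subset_sdiff_right (Set.monotone_accumulate hmn))
        ⟨0, measure_ne_top μ _⟩
      rwa [← Set.sdiff_iUnion, Set.iUnion_accumulate, Set.sdiff_self, measure_empty] at h
  refine Submodule.eq_top_iff'.2 fun f => ?_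
  refine Lp.induction hp (motive := fun f => f ∈ S) (fun c s hs hμs => ?_)
    (fun f g hf hg _ hfS hgS => S.add_mem hfS hgS) hS f
  rw [Lp.simpleFunc.coe_indicatorConst]
  have h : indicatorConstLp p hs hμs.ne c =
      c • indicatorConstLp p hs (measure_ne_top μ _) (1 : 𝕜) := by
    refine Lp.ext ?_
    filter_upwards [Lp.coeFn_smul c (indicatorConstLp p hs (measure_ne_top μ _) (1 : 𝕜)),
      indicatorConstLp_coeFn (p := p) (hs := hs) (hμs := hμs.ne) (c := c),
      indicatorConstLp_coeFn (p := p) (hs := hs) (hμs := measure_ne_top μ s) (c := (1 : 𝕜))]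
      with x h1 h2 h3
    rw [h1, h2, Pi.smul_apply, h3]
    by_cases hx : x ∈ s <;> simp [hx]
  rw [h]
  exact S.smul_mem c (hset s hs)

/-- Juxtaposition averages the `p`-th powers of `L^p` norms. -/
theorem norm_juxtaposition_rpow {𝕜 : Type*} [RCLike 𝕜] {p : ℝ≥0∞} [Fact (1 ≤ p)] (hp : p ≠ ∞)
    {f g h : Lp 𝕜 p μ01}
    (hh : ⇑h =ᵐ[μ01] fun x : ℝ => if x < 1 / 2 then f (2 * x) else g (2 * x - 1)) :
    ‖h‖ ^ p.toReal = (1 / 2) * (‖f‖ ^ p.toReal + ‖g‖ ^ p.toReal) := by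
  have hp0 : p ≠ 0 := (one_pos.trans_le Fact.out).ne'
  have hq : 0 < p.toReal := ENNReal.toReal_pos hp0 hp
  have hnorm : ∀ k : Lp 𝕜 p μ01,
      ‖k‖ ^ p.toReal = (∫⁻ x, ‖k x‖ₑ ^ p.toReal ∂μ01).toReal := fun k => by
    rw [Lp.norm_def, eLpNorm_eq_lintegral_rpow_enorm_toReal hp0 hp, ENNReal.toReal_rpow, one_div,
      ENNReal.rpow_inv_rpow hq.ne']
  have hfin : ∀ k : Lp 𝕜 p μ01, ∫⁻ x, ‖k x‖ₑ ^ p.toReal ∂μ01 ≠ ∞ := fun k =>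
    (lintegral_rpow_enorm_lt_top_of_eLpNorm_lt_top hp0 hp (Lp.eLpNorm_lt_top k)).ne
  have hmeas : ∀ k : Lp 𝕜 p μ01, AEMeasurable (fun x => ‖k x‖ₑ ^ p.toReal) μ01 := fun k =>
    (Lp.aestronglyMeasurable k).enorm.pow_const _
  have hint : ∫⁻ x, ‖h x‖ₑ ^ p.toReal ∂μ01 =
      2⁻¹ * (∫⁻ x, ‖f x‖ₑ ^ p.toReal ∂μ01 + ∫⁻ x, ‖g x‖ₑ ^ p.toReal ∂μ01) := by
    rw [← lintegral_juxtaposition (hmeas f) (hmeas g)]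
    refine lintegral_congr_ae ?_
    filter_upwards [hh] with x hx
    rw [hx]
    split_ifs <;> rfl
  rw [hnorm, hnorm, hnorm, hint, ENNReal.toReal_mul, ENNReal.toReal_add (hfin f) (hfin g)]
  simp

/-- A closed subspace of `L^p[0,1]` containing the constants and stable under juxtaposition is
everything. -/
theorem Lp_submodule_eq_top_of_juxtaposition_mem {𝕜 : Type*} [RCLike 𝕜] {p : ℝ≥0∞}
    [Fact (1 ≤ p)] (hp : p ≠ ∞) {one : Lp 𝕜 p μ01} (hone : ⇑one =ᵐ[μ01] fun _ => 1)
    (γ : Lp 𝕜 p μ01 × Lp 𝕜 p μ01 →ₗ[𝕜] Lp 𝕜 p μ01)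
    (hγ : ∀ fg : Lp 𝕜 p μ01 × Lp 𝕜 p μ01,
      ⇑(γ fg) =ᵐ[μ01] fun x : ℝ => if x < 1 / 2 then fg.1 (2 * x) else fg.2 (2 * x - 1))
    (S : Submodule 𝕜 (Lp 𝕜 p μ01)) (hS : IsClosed (S : Set (Lp 𝕜 p μ01))) (hS1 : one ∈ S)
    (hSγ : ∀ f g, f ∈ S → g ∈ S → γ (f, g) ∈ S) : S = ⊤ := by
  have hp0 : p ≠ 0 := (one_pos.trans_le Fact.out).ne'
  have hq : 0 < p.toReal := ENNReal.toReal_pos hp0 hp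
  let c : ℝ → Lp 𝕜 p μ01 := fun a =>
    indicatorConstLp p (measurableSet_Iic (a := a)) (measure_ne_top _ _) (1 : 𝕜)
  have hc : ∀ a, ⇑(c a) =ᵐ[μ01] (Set.Iic a).indicator fun _ => 1 := fun a =>
    indicatorConstLp_coeFn
  have hc_lt : ∀ a < 1 / 2, c a = γ (c (2 * a), 0) := fun a ha => by
    refine Lp.ext ?_
    filter_upwards [hc a, hγ (c (2 * a), 0),
      ae_juxtaposition (hc (2 * a)) (Lp.coeFn_zero 𝕜 p μ01)] with x h1 h2 h3
    rw [h1, h2, h3]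
    split_ifs with h
    · simp [Set.indicator_apply]
    · exact Set.indicator_of_notMem (by simp only [Set.mem_Iic]; linarith) _
  have hc_ge : ∀ a, 1 / 2 ≤ a → c a = γ (one, c (2 * a - 1)) := fun a ha => by
    refine Lp.ext ?_
    filter_upwards [hc a, hγ (one, c (2 * a - 1)),
      ae_juxtaposition hone (hc (2 * a - 1))] with x h1 h2 h3
    rw [h1, h2, h3]
    split_ifs with h
    · exact Set.indicator_of_mem (by simp only [Set.mem_Iic]; linarith) _
    · simp [Set.indicator_apply]
  have happrox : ∀ (n : ℕ) (a : ℝ), ∃ s ∈ S, ‖c a - s‖ ^ p.toReal ≤ (1 / 2) ^ n := by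
    intro n
    induction n with
    | zero =>
      intro a
      refine ⟨0, S.zero_mem, ?_⟩
      rw [sub_zero, pow_zero]
      refine Real.rpow_le_one (norm_nonneg _) ?_ hq.le
      refine norm_indicatorConstLp_le.trans ?_
      rw [norm_one, one_mul]
      refine Real.rpow_le_one measureReal_nonneg ?_ (by positivity)
      exact (measureReal_mono (Set.subset_univ _)).trans (by simp)
    | succ n ih =>
      intro a
      rcases lt_or_ge a (1 / 2) with ha | ha
      · obtain ⟨s, hs, hle⟩ := ih (2 * a)
        refine ⟨γ (s, 0), hSγ _ _ hs S.zero_mem, ?_⟩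
        rw [hc_lt a ha, ← map_sub, norm_juxtaposition_rpow hp (hγ _), Prod.fst_sub, Prod.snd_sub,
          sub_self, norm_zero, Real.zero_rpow hq.ne', pow_succ]
        linarith
      · obtain ⟨s, hs, hle⟩ := ih (2 * a - 1)
        refine ⟨γ (one, s), hSγ _ _ hS1 hs, ?_⟩
        rw [hc_ge a ha, ← map_sub, norm_juxtaposition_rpow hp (hγ _), Prod.fst_sub, Prod.snd_sub,
          sub_self, norm_zero, Real.zero_rpow hq.ne', pow_succ]
        linarith
  refine Lp_submodule_eq_top_of_Iic_mem hp S hS ?_ fun a => ?_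
  · convert hS1
    refine Lp.ext ?_
    filter_upwards [hone, indicatorConstLp_coeFn (p := p) (hs := MeasurableSet.univ)
      (hμs := measure_ne_top (μ01) _) (c := (1 : 𝕜))] with x h1 h2
    rw [h1, h2, Set.indicator_univ]
  · change c a ∈ (S : Set (Lp 𝕜 p μ01))
    rw [← hS.closure_eq, Metric.mem_closure_iff]
    intro ε hε
    obtain ⟨n, hn⟩ := exists_pow_lt_of_lt_one (Real.rpow_pos_of_pos hε p.toReal)
      (by norm_num : (1 / 2 : ℝ) < 1)
    obtain ⟨s, hs, hle⟩ := happrox n a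
    refine ⟨s, hs, ?_⟩
    rw [dist_eq_norm]
    exact (Real.rpow_lt_rpow_iff (norm_nonneg _) hε.le hq).1 (hle.trans_lt hn)

/-- Juxtaposition of `L^p` functions is linear. -/
theorem isLinearMap_juxtaposition {𝕜 : Type*} [RCLike 𝕜] {p : ℝ≥0∞} [Fact (1 ≤ p)]
    (γ : Lp 𝕜 p μ01 × Lp 𝕜 p μ01 → Lp 𝕜 p μ01)
    (hγ : ∀ fg : Lp 𝕜 p μ01 × Lp 𝕜 p μ01,
      ⇑(γ fg) =ᵐ[μ01] fun x : ℝ => if x < 1 / 2 then fg.1 (2 * x) else fg.2 (2 * x - 1)) :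
    IsLinearMap 𝕜 γ where
  map_add a b := by
    refine Lp.ext ?_
    filter_upwards [hγ (a + b), hγ a, hγ b, Lp.coeFn_add (γ a) (γ b),
      ae_juxtaposition (Lp.coeFn_add a.1 b.1) (Lp.coeFn_add a.2 b.2)] with x h1 h2 h3 h4 h5
    rw [h4, Pi.add_apply, h1, h2, h3, Prod.fst_add, Prod.snd_add, h5]
    split_ifs <;> rfl
  map_smul c a := by
    refine Lp.ext ?_
    filter_upwards [hγ (c • a), hγ a, Lp.coeFn_smul c (γ a),
      ae_juxtaposition (Lp.coeFn_smul c a.1) (Lp.coeFn_smul c a.2)] with x h1 h2 h3 h4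
    rw [h3, Pi.smul_apply, h1, h2, Prod.smul_fst, Prod.smul_snd, h4]
    split_ifs <;> rfl

/-- The normalized `ℓ^q` norm of a pair is at most its sup norm. -/
theorem average_rpow_le_norm {E F : Type*} [SeminormedAddCommGroup E] [SeminormedAddCommGroup F]
    {q : ℝ} (hq : 0 < q) (a : E × F) :
    ((1 / 2) * (‖a.1‖ ^ q + ‖a.2‖ ^ q)) ^ (1 / q) ≤ ‖a‖ := by
  have h1 : ‖a.1‖ ^ q ≤ ‖a‖ ^ q :=
    Real.rpow_le_rpow (norm_nonneg _) (norm_fst_le a) hq.le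
  have h2 : ‖a.2‖ ^ q ≤ ‖a‖ ^ q :=
    Real.rpow_le_rpow (norm_nonneg _) (norm_snd_le a) hq.le
  calc ((1 / 2) * (‖a.1‖ ^ q + ‖a.2‖ ^ q)) ^ (1 / q) ≤ (‖a‖ ^ q) ^ (1 / q) :=
        Real.rpow_le_rpow (by positivity) (by linarith) (by positivity)
    _ = ‖a‖ := by rw [one_div, Real.rpow_rpow_inv (norm_nonneg _) hq.ne']

section Abstract

variable {𝕜 E V : Type*} [RCLike 𝕜] [NormedAddCommGroup E] [NormedSpace 𝕜 E]
  [NormedAddCommGroup V] [NormedSpace 𝕜 V]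

/-- The submodule of points at which a sequence of linear maps is Cauchy. -/
def cauchySubmodule (T : ℕ → E →ₗ[𝕜] V) : Submodule 𝕜 E where
  carrier := {f | CauchySeq fun n => T n f}
  add_mem' hf hg := by simpa [Pi.add_def] using CauchySeq.add hf hg
  zero_mem' := by simpa using cauchySeq_const (0 : V)
  smul_mem' c f hf := by
    simpa [Function.comp_def] using (uniformContinuous_const_smul c).comp_cauchySeq hf

theorem isClosed_cauchySubmodule (T : ℕ → E →ₗ[𝕜] V) (hT : ∀ n f, ‖T n f‖ ≤ ‖f‖) :
    IsClosed (cauchySubmodule T : Set E) := by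
  refine isClosed_of_closure_subset fun f hf => ?_
  refine Metric.cauchySeq_iff.2 fun ε hε => ?_
  obtain ⟨g, hg, hfg⟩ := Metric.mem_closure_iff.1 hf (ε / 3) (by positivity)
  obtain ⟨N, hN⟩ := Metric.cauchySeq_iff.1 hg (ε / 3) (by positivity)
  refine ⟨N, fun m hm n hn => ?_⟩
  have key : ∀ k, dist (T k f) (T k g) < ε / 3 := fun k => by
    rw [dist_eq_norm, ← map_sub]
    exact (hT k _).trans_lt (by rwa [← dist_eq_norm])
  have h1 := key m
  have h2 := key n
  rw [dist_comm] at h2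
  linarith [hN m hm n hn, dist_triangle4 (T m f) (T m g) (T n g) (T n f)]

/-- A juxtaposition that averages `q`-th powers of norms is onto, provided the closed
juxtaposition-stable subspaces containing `e` are trivial. -/
theorem surjective_of_norm_rpow_eq [CompleteSpace E] {q : ℝ} (hq : 0 < q) (γ : E × E →ₗ[𝕜] E)
    (hγ : ∀ a, ‖γ a‖ ^ q = (1 / 2) * (‖a.1‖ ^ q + ‖a.2‖ ^ q)) {e : E} (he : γ (e, e) = e)
    (hgen : ∀ S : Submodule 𝕜 E, IsClosed (S : Set E) → e ∈ S →
      (∀ f g, f ∈ S → g ∈ S → γ (f, g) ∈ S) → S = ⊤) :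
    Function.Surjective γ := by
  have hle : ∀ a, ‖γ a‖ ≤ ‖a‖ := fun a => by
    rw [← Real.rpow_rpow_inv (norm_nonneg (γ a)) hq.ne', hγ, ← one_div]
    exact average_rpow_le_norm hq a
  have hge : ∀ a, ‖a‖ ≤ 2 ^ (1 / q) * ‖γ a‖ := fun a => by
    have h : ∀ t : ℝ, 0 ≤ t → t ^ q ≤ 2 * ‖γ a‖ ^ q → t ≤ 2 ^ (1 / q) * ‖γ a‖ := by
      intro t ht h
      rw [← Real.rpow_le_rpow_iff ht (by positivity) hq,
        Real.mul_rpow (by positivity) (by positivity), ← Real.rpow_mul (by norm_num),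
        one_div_mul_cancel hq.ne', Real.rpow_one]
      exact h
    have h1 : 0 ≤ ‖a.1‖ ^ q := by positivity
    have h2 : 0 ≤ ‖a.2‖ ^ q := by positivity
    exact max_le (h _ (norm_nonneg _) (by rw [hγ]; linarith))
      (h _ (norm_nonneg _) (by rw [hγ]; linarith))
  have hclosed : IsClosed (LinearMap.range γ : Set E) := by
    have hanti : AntilipschitzWith (⟨2 ^ (1 / q), by positivity⟩ : NNReal) γ :=
      AddMonoidHomClass.antilipschitz_of_bound γ hge
    have hunif : UniformContinuous γ :=
      (γ.mkContinuous 1 fun a => by simpa using hle a).uniformContinuous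
    rw [LinearMap.coe_range]
    exact hanti.isClosed_range hunif
  exact LinearMap.range_eq_top.1
    (hgen _ hclosed ⟨_, he⟩ fun f g _ _ => LinearMap.mem_range_self γ (f, g))

/-- Universal property of a self-similar pointed Banach space. -/
theorem existsUnique_contraction_of_juxtaposition [CompleteSpace E] [CompleteSpace V]
    {q : ℝ} (hq : 0 < q) (γ : E × E →ₗ[𝕜] E)
    (hγ : ∀ a, ‖γ a‖ ^ q = (1 / 2) * (‖a.1‖ ^ q + ‖a.2‖ ^ q)) {e : E} (he : γ (e, e) = e)
    (hgen : ∀ S : Submodule 𝕜 E, IsClosed (S : Set E) → e ∈ S →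
      (∀ f g, f ∈ S → g ∈ S → γ (f, g) ∈ S) → S = ⊤)
    (henorm : ‖e‖ = 1) (v : V) (hv : ‖v‖ ≤ 1) (δ : V × V →ₗ[𝕜] V)
    (hδ : ∀ a, ‖δ a‖ ≤ ((1 / 2) * (‖a.1‖ ^ q + ‖a.2‖ ^ q)) ^ (1 / q))
    (hδv : δ (v, v) = v) :
    ∃! θ : E →L[𝕜] V, ‖θ‖ ≤ 1 ∧ θ e = v ∧ ∀ f g, θ (γ (f, g)) = δ (θ f, θ g) := by
  have hγnorm : ∀ a, ‖γ a‖ = ((1 / 2) * (‖a.1‖ ^ q + ‖a.2‖ ^ q)) ^ (1 / q) := fun a => by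
    rw [← hγ, one_div, Real.rpow_rpow_inv (norm_nonneg _) hq.ne']
  have hinj : Function.Injective γ := by
    refine (injective_iff_map_eq_zero γ).2 fun a ha => ?_
    have h := hγ a
    rw [ha, norm_zero, Real.zero_rpow hq.ne'] at h
    have h1 : 0 ≤ ‖a.1‖ ^ q := by positivity
    have h2 : 0 ≤ ‖a.2‖ ^ q := by positivity
    have h3 : ‖a.1‖ ^ q = 0 := by linarith
    have h4 : ‖a.2‖ ^ q = 0 := by linarith
    rw [Real.rpow_eq_zero (norm_nonneg _) hq.ne', norm_eq_zero] at h3 h4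
    exact Prod.ext h3 h4
  let Γ : (E × E) ≃ₗ[𝕜] E :=
    LinearEquiv.ofBijective γ ⟨hinj, surjective_of_norm_rpow_eq hq γ hγ he hgen⟩
  have hΓ : ∀ a, Γ.symm (γ a) = a := fun a => Γ.symm_apply_apply a
  have hδcont : UniformContinuous δ :=
    (δ.mkContinuous 1 fun a => by
      simpa using (hδ a).trans (average_rpow_le_norm hq a)).uniformContinuous
  obtain ⟨φ, hφ, hφe⟩ := exists_dual_vector 𝕜 e (by rw [henorm]; exact one_ne_zero)
  let T : ℕ → E →ₗ[𝕜] V := fun n => Nat.rec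
    (φ.smulRight v).toLinearMap
    (fun _ θ => δ ∘ₗ θ.prodMap θ ∘ₗ Γ.symm.toLinearMap) n
  have hTsucc : ∀ n f g, T (n + 1) (γ (f, g)) = δ (T n f, T n g) := fun n f g => by
    change δ ((T n).prodMap (T n) (Γ.symm (γ (f, g)))) = _
    rw [hΓ]
    rfl
  have hTnorm : ∀ n f, ‖T n f‖ ≤ ‖f‖ := by
    intro n
    induction n with
    | zero =>
      intro f
      refine (norm_smul_le _ _).trans ?_
      refine (mul_le_of_le_one_right (norm_nonneg _) hv).trans ?_
      exact (ContinuousLinearMap.le_opNorm _ f).trans (by rw [hφ, one_mul])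
    | succ n ih =>
      intro f
      obtain ⟨a, rfl⟩ := Γ.surjective f
      change ‖T (n + 1) (γ (a.1, a.2))‖ ≤ ‖γ a‖
      rw [hTsucc, hγnorm]
      refine (hδ _).trans ?_
      have h1 := ih a.1
      have h2 := ih a.2
      dsimp only
      gcongr
  have hTe : ∀ n, T n e = v := by
    intro n
    induction n with
    | zero =>
      change φ e • v = v
      simp [hφe, henorm]
    | succ n ih => rw [← he, hTsucc, ih, hδv]
  have htop : cauchySubmodule T = ⊤ := by
    refine hgen _ (isClosed_cauchySubmodule T hTnorm) ?_ fun f g hf hg => ?_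
    · change CauchySeq fun n => T n e
      simpa only [hTe] using cauchySeq_const v
    · change CauchySeq fun n => T n (γ (f, g))
      have h : CauchySeq fun n => δ (T n f, T n g) :=
        hδcont.comp_cauchySeq (CauchySeq.prodMk hf hg)
      refine (cauchySeq_shift 1).1 ?_
      simpa only [hTsucc] using h
  have hlim : ∀ f, ∃ w, Filter.Tendsto (fun n => T n f) Filter.atTop (nhds w) := fun f =>
    cauchySeq_tendsto_of_complete (by
      have : f ∈ cauchySubmodule T := htop ▸ Submodule.mem_top
      exact this)
  choose θ hθ using hlim
  let Θ : E →ₗ[𝕜] V := linearMapOfTendsto θ T (tendsto_pi_nhds.2 hθ)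
  have hΘ : ∀ f, ‖Θ f‖ ≤ 1 * ‖f‖ := fun f => by
    rw [one_mul]
    exact le_of_tendsto (hθ f).norm (Filter.Eventually.of_forall fun n => hTnorm n f)
  set ψ := Θ.mkContinuous 1 hΘ
  have hψe : ψ e = v :=
    tendsto_nhds_unique (hθ e) (by simpa only [hTe] using tendsto_const_nhds)
  have hψ : ∀ f g, ψ (γ (f, g)) = δ (ψ f, ψ g) := fun f g => by
    refine tendsto_nhds_unique ((hθ (γ (f, g))).comp (Filter.tendsto_add_atTop_nat 1)) ?_
    simp only [Function.comp_def, hTsucc]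
    exact (hδcont.continuous.tendsto _).comp ((hθ f).prodMk_nhds (hθ g))
  refine ⟨ψ, ⟨Θ.mkContinuous_norm_le zero_le_one hΘ, hψe, hψ⟩, ?_⟩
  rintro χ ⟨-, hχe, hχ⟩
  have h : LinearMap.eqLocus χ.toLinearMap ψ.toLinearMap = ⊤ :=
    hgen _ (isClosed_eq χ.continuous ψ.continuous) (hχe.trans hψe.symm) fun f g hf hg => by
      change χ (γ (f, g)) = ψ (γ (f, g))
      have hf' : χ f = ψ f := hf
      have hg' : χ g = ψ g := hg
      rw [hχ, hψ, hf', hg']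
  ext f
  have : f ∈ LinearMap.eqLocus χ.toLinearMap ψ.toLinearMap := h ▸ Submodule.mem_top
  exact this

end Abstract

/-- universal property of `L^p[0,1]`, `1 ≤ p < ∞`: given a Banach space
`V`, `v ∈ V` with `‖v‖ ≤ 1` and a linear contraction `δ : V ⊕_p V → V` with
`δ(v,v) = v`, there is a unique linear contraction `θ : L^p[0,1] → V` with `θ(1) = v`
and `θ ∘ γ = δ ∘ (θ ⊕ θ)`. -/
theorem stmt_3 {𝕜 V : Type*} [RCLike 𝕜] [NormedAddCommGroup V] [NormedSpace 𝕜 V]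
    [CompleteSpace V]
    (p : ℝ≥0∞) [Fact (1 ≤ p)] (hp' : p ≠ ∞)
    (v : V) (hv : ‖v‖ ≤ 1)
    (δ : V × V →ₗ[𝕜] V)
    (hδ : ∀ a : V × V, ‖δ a‖ ≤ ((1/2) * (‖a.1‖ ^ p.toReal + ‖a.2‖ ^ p.toReal)) ^ (1/p.toReal))
    (hδv : δ (v, v) = v)
    (one : Lp 𝕜 p μ01) (hone : ⇑one =ᵐ[μ01] fun _ => 1)
    (γ : Lp 𝕜 p μ01 × Lp 𝕜 p μ01 → Lp 𝕜 p μ01)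
    (hγ : ∀ fg : Lp 𝕜 p μ01 × Lp 𝕜 p μ01,
      ⇑(γ fg) =ᵐ[μ01] fun x : ℝ => if x < 1/2 then fg.1 (2 * x) else fg.2 (2 * x - 1)) :
    ∃! θ : Lp 𝕜 p μ01 →L[𝕜] V, ‖θ‖ ≤ 1 ∧ θ one = v ∧
      ∀ f g : Lp 𝕜 p μ01, θ (γ (f, g)) = δ (θ f, θ g) := by
  have hp0 : p ≠ 0 := (one_pos.trans_le Fact.out).ne'
  have hq : 0 < p.toReal := ENNReal.toReal_pos hp0 hp'
  have hone_juxt : γ (one, one) = one := by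
    refine Lp.ext ?_
    filter_upwards [hγ (one, one), ae_juxtaposition hone hone, hone] with x h1 h2 h3
    rw [h1, h2, h3, ite_self]
  have hone_norm : ‖one‖ = 1 := by
    rw [Lp.norm_def, eLpNorm_congr_ae hone,
      eLpNorm_const' (1 : 𝕜) hp0 hp']
    simp
  let γl : Lp 𝕜 p μ01 × Lp 𝕜 p μ01 →ₗ[𝕜] Lp 𝕜 p μ01 :=
    (isLinearMap_juxtaposition γ hγ).mk' γ
  exact existsUnique_contraction_of_juxtaposition hq γl
    (fun a => norm_juxtaposition_rpow hp' (hγ a)) hone_juxt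
    (Lp_submodule_eq_top_of_juxtaposition_mem hp' hone γl hγ) hone_norm v hv δ hδ hδv
end

section
/- The integration functional ∫₀¹ : L^1[0,1] → 𝔽 is the unique bounded linear functional on L^1[0,1] such that ∫₀¹ 1 = 1 and ∫₀¹ f(x) dx = (1/2)(∫₀¹ f(x/2) dx + ∫₀¹ f((x+1)/2) dx) for all f ∈ L^1[0,1]. -/
open MeasureTheory

local notation "μ01" => MeasureTheory.volume.restrict (Set.Icc (0:ℝ) 1)

/-- Almost everywhere statements on `[0,1]` pull back along the maps `x ↦ (x + c) / 2` with
`c ∈ [0,1]`. -/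
theorem ae_comp_half {c : ℝ} (hc : c ∈ Set.Icc (0:ℝ) 1) {p : ℝ → Prop} (hp : ∀ᵐ x ∂μ01, p x) :
    ∀ᵐ x ∂μ01, p ((x + c) / 2) := by
  rw [ae_restrict_iff' measurableSet_Icc] at hp ⊢
  have hmul : Measure.QuasiMeasurePreserving (fun x : ℝ => 2⁻¹ * x) volume volume :=
    ⟨by fun_prop, by
      rw [Real.map_volume_mul_left (by norm_num)]
      exact Measure.smul_absolutelyContinuous⟩
  have hadd := (measurePreserving_add_right (volume : Measure ℝ) c).quasiMeasurePreserving
  filter_upwards [(hmul.comp hadd).ae hp] with x hx hx01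
  have e : (x + c) / 2 = 2⁻¹ * (x + c) := by ring
  rw [e]
  refine hx ⟨?_, ?_⟩ <;> simp only [Function.comp] <;> linarith [hx01.1, hx01.2, hc.1, hc.2]

theorem integral_eq_half_add_half {𝕜 : Type*} [RCLike 𝕜] {f g h : ℝ → 𝕜} (hf : Integrable f μ01)
    (hg : g =ᵐ[μ01] fun x => f (x / 2)) (hh : h =ᵐ[μ01] fun x => f ((x + 1) / 2)) :
    ∫ x, f x ∂μ01 = (1/2 : 𝕜) * (∫ x, g x ∂μ01 + ∫ x, h x ∂μ01) := by
  rw [integral_congr_ae hg, integral_congr_ae hh]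
  have hI : ∀ a b : ℝ, a ∈ Set.Icc (0:ℝ) 1 → b ∈ Set.Icc (0:ℝ) 1 →
      IntervalIntegrable f volume a b := fun a b ha hb =>
    IntegrableOn.intervalIntegrable
      (hf.mono_measure (Measure.restrict_mono (Set.uIcc_subset_Icc ha hb) le_rfl))
  have hsum := intervalIntegral.integral_add_adjacent_intervals
    (hI 0 (1/2) (by norm_num) (by norm_num)) (hI (1/2) 1 (by norm_num) (by norm_num))
  simp only [add_div, integral_Icc_eq_integral_Ioc,
    ← intervalIntegral.integral_of_le (zero_le_one' ℝ)]
  rw [intervalIntegral.integral_comp_div f (two_ne_zero' ℝ),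
    intervalIntegral.integral_comp_div_add f (two_ne_zero' ℝ), ← hsum, ← smul_add]
  norm_num [RCLike.real_smul_eq_coe_mul]
  rw [RCLike.ofReal_ofNat]
  ring

/-- A bounded functional on `L¹[0,1]` that vanishes on constants and is invariant under the
bisection of `[0,1]` is controlled on continuous functions by their modulus of continuity. -/
theorem norm_toLp_le_of_modulus {𝕜 : Type*} [RCLike 𝕜] (ψ : Lp 𝕜 1 μ01 →L[𝕜] 𝕜)
    (hconst : ∀ c : 𝕜, ψ (BoundedContinuousFunction.toLp 1 μ01 𝕜
      (BoundedContinuousFunction.const ℝ c)) = 0)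
    (hψ : ∀ f g h : Lp 𝕜 1 μ01,
        (⇑g =ᵐ[μ01] fun x : ℝ => f (x / 2)) →
        (⇑h =ᵐ[μ01] fun x : ℝ => f ((x + 1) / 2)) →
        ψ f = (1/2 : 𝕜) * (ψ g + ψ h))
    {ε : ℝ} (hε : 0 ≤ ε) (n : ℕ) (δ : ℝ) (hδ : 1 ≤ 2 ^ n * δ)
    (F : BoundedContinuousFunction ℝ 𝕜)
    (hF : ∀ x ∈ Set.Icc (0:ℝ) 1, ∀ y ∈ Set.Icc (0:ℝ) 1, |x - y| ≤ δ → ‖F x - F y‖ ≤ ε) :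
    ‖ψ (BoundedContinuousFunction.toLp 1 μ01 𝕜 F)‖ ≤ ‖ψ‖ * ε := by
  induction n generalizing δ F with
  | zero =>
    have hb : ‖BoundedContinuousFunction.toLp 1 μ01 𝕜
        (F - BoundedContinuousFunction.const ℝ (F 0))‖ ≤ ε := by
      have hae : ∀ᵐ x ∂μ01, ‖BoundedContinuousFunction.toLp 1 μ01 𝕜
          (F - BoundedContinuousFunction.const ℝ (F 0)) x‖ ≤ ε := by
        filter_upwards [BoundedContinuousFunction.coeFn_toLp (p := 1) (𝕜 := 𝕜) μ01
          (F - BoundedContinuousFunction.const ℝ (F 0)),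
          ae_restrict_mem measurableSet_Icc] with x h1 hx
        rw [h1]
        refine hF x hx 0 (by norm_num) ?_
        rw [sub_zero, abs_of_nonneg hx.1]
        linarith [hx.2]
      simpa [measureUnivNNReal] using Lp.norm_le_of_ae_bound hε hae
    have hs : ψ (BoundedContinuousFunction.toLp 1 μ01 𝕜 F) = ψ (BoundedContinuousFunction.toLp 1
        μ01 𝕜 (F - BoundedContinuousFunction.const ℝ (F 0))) := by
      rw [map_sub, map_sub, hconst, sub_zero]
    rw [hs]
    exact (ψ.le_opNorm _).trans (by gcongr)
  | succ n ih =>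
    have hcomp : ∀ c ∈ Set.Icc (0:ℝ) 1, ∃ G : BoundedContinuousFunction ℝ 𝕜,
        (⇑(BoundedContinuousFunction.toLp 1 μ01 𝕜 G) =ᵐ[μ01] fun x : ℝ =>
          BoundedContinuousFunction.toLp 1 μ01 𝕜 F ((x + c) / 2)) ∧
        ‖ψ (BoundedContinuousFunction.toLp 1 μ01 𝕜 G)‖ ≤ ‖ψ‖ * ε := by
      intro c hc
      refine ⟨F.compContinuous ⟨fun x => (x + c) / 2, by fun_prop⟩, ?_, ?_⟩
      · filter_upwards [BoundedContinuousFunction.coeFn_toLp (p := 1) (𝕜 := 𝕜) μ01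
          (F.compContinuous ⟨fun x => (x + c) / 2, by fun_prop⟩),
          ae_comp_half hc (BoundedContinuousFunction.coeFn_toLp (p := 1) (𝕜 := 𝕜) μ01 F)]
          with x h1 h2
        rw [h1, h2]
        rfl
      · refine ih (2 * δ) (by rw [pow_succ] at hδ; linarith) _ fun x hx y hy hxy => ?_
        refine hF ((x + c) / 2) ⟨?_, ?_⟩ ((y + c) / 2) ⟨?_, ?_⟩ ?_
        any_goals linarith [hx.1, hx.2, hy.1, hy.2, hc.1, hc.2]
        rw [show (x + c) / 2 - (y + c) / 2 = (x - y) / 2 by ring, abs_div, abs_two]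
        linarith
    obtain ⟨G, hG, hGb⟩ := hcomp 0 (by norm_num)
    obtain ⟨H, hH, hHb⟩ := hcomp 1 (by norm_num)
    rw [hψ _ _ _ (by simpa using hG) hH, norm_mul]
    have h2 : ‖(1 / 2 : 𝕜)‖ = 1 / 2 := by simp
    rw [h2]
    linarith [norm_add_le (ψ (BoundedContinuousFunction.toLp 1 μ01 𝕜 G))
      (ψ (BoundedContinuousFunction.toLp 1 μ01 𝕜 H))]

/-- `∫₀¹` is the unique bounded linear functional `θ` on `L¹[0,1]` with
`θ(1) = 1` and `θ(f) = (1/2)(θ(f(·/2)) + θ(f((·+1)/2)))` for all `f`. -/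
theorem stmt_4 {𝕜 : Type*} [RCLike 𝕜]
    (one : Lp 𝕜 1 μ01) (hone : ⇑one =ᵐ[μ01] fun _ => 1)
    (θ : Lp 𝕜 1 μ01 →L[𝕜] 𝕜) :
    (θ one = 1 ∧
      ∀ f g h : Lp 𝕜 1 μ01,
        (⇑g =ᵐ[μ01] fun x : ℝ => f (x / 2)) →
        (⇑h =ᵐ[μ01] fun x : ℝ => f ((x + 1) / 2)) →
        θ f = (1/2 : 𝕜) * (θ g + θ h))
    ↔ (∀ f : Lp 𝕜 1 μ01, θ f = ∫ x, f x ∂μ01) := by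
  have hint_one : ∫ x, one x ∂μ01 = 1 := by
    rw [integral_congr_ae hone]
    simp
  constructor
  · rintro ⟨h1, hθ⟩
    obtain ⟨I, hI⟩ : ∃ I : Lp 𝕜 1 μ01 →L[𝕜] 𝕜, ∀ f, I f = ∫ x, f x ∂μ01 :=
      ⟨LinearMap.mkContinuous ⟨⟨L1.integral, L1.integral_add⟩, L1.integral_smul⟩ 1
        fun f => (L1.norm_integral_le f).trans_eq (one_mul _).symm,
        fun f => L1.integral_eq_integral f⟩
    have hψ : ∀ f g h : Lp 𝕜 1 μ01,
        (⇑g =ᵐ[μ01] fun x : ℝ => f (x / 2)) →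
        (⇑h =ᵐ[μ01] fun x : ℝ => f ((x + 1) / 2)) →
        (θ - I) f = (1/2 : 𝕜) * ((θ - I) g + (θ - I) h) := by
      intro f g h hg hh
      simp only [sub_apply]
      rw [hθ f g h hg hh, hI f, hI g, hI h,
        integral_eq_half_add_half (L1.integrable_coeFn f) hg hh]
      ring
    have hconst : ∀ c : 𝕜, (θ - I) (BoundedContinuousFunction.toLp 1 μ01 𝕜
        (BoundedContinuousFunction.const ℝ c)) = 0 := by
      intro c
      have e : BoundedContinuousFunction.toLp 1 μ01 𝕜
          (BoundedContinuousFunction.const ℝ c) = c • one := by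
        refine Lp.ext ?_
        filter_upwards [BoundedContinuousFunction.coeFn_toLp (p := 1) (𝕜 := 𝕜) μ01
          (BoundedContinuousFunction.const ℝ c), Lp.coeFn_smul c one, hone] with x ha hb hx
        rw [ha, hb, Pi.smul_apply, hx]
        simp
      rw [e, map_smul, sub_apply, h1, hI, hint_one, sub_self, smul_zero]
    have hzero : ∀ F : BoundedContinuousFunction ℝ 𝕜,
        (θ - I) (BoundedContinuousFunction.toLp 1 μ01 𝕜 F) = 0 := by
      intro F
      have hle : ∀ ε > 0, ‖(θ - I) (BoundedContinuousFunction.toLp 1 μ01 𝕜 F)‖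
          ≤ ‖θ - I‖ * ε := by
        intro ε hε
        obtain ⟨δ, hδ, hF⟩ := Metric.uniformContinuousOn_iff_le.1
          (isCompact_Icc.uniformContinuousOn_of_continuous
            (F.continuous.continuousOn (s := Set.Icc (0:ℝ) 1))) ε hε
        obtain ⟨n, hn⟩ := pow_unbounded_of_one_lt δ⁻¹ (one_lt_two (α := ℝ))
        refine norm_toLp_le_of_modulus _ hconst hψ hε.le n δ ?_ F fun x hx y hy hxy => ?_
        · rw [inv_lt_iff_one_lt_mul₀ hδ] at hn
          linarith
        · rw [← dist_eq_norm]
          exact hF x hx y hy hxy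
      have hlim : Filter.Tendsto (fun ε : ℝ => ‖θ - I‖ * ε) (nhdsWithin 0 (Set.Ioi 0))
          (nhds 0) := by
        have : Continuous fun ε : ℝ => ‖θ - I‖ * ε := by fun_prop
        simpa using (this.tendsto 0).mono_left nhdsWithin_le_nhds
      exact norm_le_zero_iff.1 (ge_of_tendsto hlim
        (Filter.eventually_of_mem self_mem_nhdsWithin hle))
    intro f
    have hdense := BoundedContinuousFunction.toLp_denseRange 𝕜 μ01 𝕜 (p := 1) (by simp)
    have := congrFun (hdense.equalizer (θ - I).continuous (continuous_const (y := (0:𝕜)))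
      (funext hzero)) f
    rw [← hI]
    exact sub_eq_zero.1 this
  · intro hθ
    refine ⟨by rw [hθ, hint_one], fun f g h hg hh => ?_⟩
    rw [hθ f, hθ g, hθ h]
    exact integral_eq_half_add_half (L1.integrable_coeFn f) hg hh
end
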